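/- Let q = mp/(r(r-1)) + 2 sqrt(13 m ln r / r) + ((r+1)/r)(n/ln n) with r ≥ 2, r < (ln n)^{1/5}, m ≥ n²(r-1)/(2 ln n), p = ((r-1)/r) ln(n/ln n)/n, and let X ~ Bin(m, q/m). Then P(X < q - sqrt(13 m ln r / r)) ≤ exp(-(13 m ln r / r)/(2q)) ≤ r^{-1/p} for all sufficiently large n. -/

import Mathlib

theorem exp_neg_le_one_sub_add_sq_div_two {t : ℝ} (ht : 0 ≤ t) :
    Real.exp (-t) ≤ 1 - t + t ^ 2 / 2 := by
  have h := Real.quadratic_le_exp_of_nonneg ht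
  have hpos : 0 < 1 + t + t ^ 2 / 2 := by positivity
  rw [Real.exp_neg]
  refine (inv_anti₀ hpos h).trans ?_
  rw [inv_le_iff_one_le_mul₀ hpos]
  nlinarith [sq_nonneg (t ^ 2)]

/-- Chernoff's bound for the lower tail of the binomial distribution with mean `q`. -/
theorem sum_binomial_lower_tail_le {m : ℕ} {q z : ℝ} (hm : 0 < m) (hq : 0 < q)
    (hqm : q ≤ m) (hz : 0 ≤ z) :
    ∑ i ∈ (Finset.range (m + 1)).filter (fun i : ℕ => (i : ℝ) < q - z),
        (m.choose i : ℝ) * (q / m) ^ i * (1 - q / m) ^ (m - i) ≤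
      Real.exp (-z ^ 2 / (2 * q)) := by
  have hm' : (0 : ℝ) < m := by exact_mod_cast hm
  set x := q / m with hx
  have hx0 : 0 ≤ x := by positivity
  have hx1 : 0 ≤ 1 - x := sub_nonneg.2 ((div_le_one hm').2 hqm)
  have hmx : m * x = q := by rw [hx]; field_simp
  set t := z / q with ht
  have ht0 : 0 ≤ t := by positivity
  have htq : t * q = z := by rw [ht]; field_simp
  calc
    _ ≤ ∑ i ∈ Finset.range (m + 1), Real.exp (t * (q - z)) *
          ((x * Real.exp (-t)) ^ i * (1 - x) ^ (m - i) * (m.choose i : ℝ)) := by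
      refine (Finset.sum_le_sum fun i hi => ?_).trans
        (Finset.sum_le_sum_of_subset_of_nonneg (Finset.filter_subset _ _)
          fun i _ _ => by positivity)
      have hi' := (Finset.mem_filter.1 hi).2
      have hone : 1 ≤ Real.exp (t * (q - z)) * Real.exp (-t) ^ i := by
        rw [← Real.exp_nat_mul, ← Real.exp_add]
        apply Real.one_le_exp
        nlinarith [mul_nonneg ht0 (sub_nonneg.2 hi'.le)]
      have hnn : 0 ≤ (m.choose i : ℝ) * x ^ i * (1 - x) ^ (m - i) := by positivity
      refine (le_mul_of_one_le_right hnn hone).trans_eq ?_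
      rw [mul_pow]
      ring
    _ = Real.exp (t * (q - z)) * (x * Real.exp (-t) + (1 - x)) ^ m := by
      rw [← Finset.mul_sum, ← add_pow]
    _ ≤ Real.exp (t * (q - z)) * Real.exp (x * (-t + t ^ 2 / 2)) ^ m := by
      gcongr
      have h1 := mul_le_mul_of_nonneg_left (exp_neg_le_one_sub_add_sq_div_two ht0) hx0
      have h2 := Real.add_one_le_exp (x * (-t + t ^ 2 / 2))
      linarith
    _ = Real.exp (-z ^ 2 / (2 * q)) := by
      rw [← Real.exp_nat_mul, ← Real.exp_add, ← mul_assoc, hmx, ht]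
      congr 1
      field_simp
      ring

/-- Size estimates that hold for large `n`, where `L = log n` and `l = log (n / log n)`. -/
theorem mean_le_two_mul_main_term {n L l m r : ℝ} (hn : 0 < n) (hl : L / 2 ≤ l)
    (hr : 2 ≤ r) (hLr : 1664 * r ^ 3 ≤ L) (hm : n ^ 2 * (r - 1) / (2 * L) ≤ m) :
    m * l / (r ^ 2 * n) + 2 * Real.sqrt (13 * m * Real.log r / r) + (r + 1) / r * (n / L) ≤
      2 * (m * l / (r ^ 2 * n)) := by
  have hr0 : 0 < r := by linarith
  have hr1 : 0 < r - 1 := by linarith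
  have hL : 0 < L := lt_of_lt_of_le (by positivity) hLr
  have hl0 : 0 < l := by linarith
  have hm0 : 0 < m := lt_of_lt_of_le (by positivity) hm
  have hm2 : n ^ 2 * (r - 1) ≤ m * (2 * L) := (div_le_iff₀ (by positivity)).1 hm
  have hsqrt : Real.sqrt (13 * m * Real.log r / r) ≤ m * l / (r ^ 2 * n) / 4 := by
    apply Real.sqrt_le_iff.2 ⟨by positivity, ?_⟩
    have hlog : Real.log r ≤ r - 1 := Real.log_le_sub_one_of_pos hr0
    have hsq : L ^ 2 / 4 ≤ l ^ 2 := by nlinarith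
    have hml : 208 * (r - 1) * r ^ 3 * n ^ 2 ≤ m * l ^ 2 := by
      calc 208 * (r - 1) * r ^ 3 * n ^ 2 = n ^ 2 * (r - 1) * (1664 * r ^ 3) / 8 := by ring
        _ ≤ m * (2 * L) * L / 8 := by gcongr
        _ = m * (L ^ 2 / 4) := by ring
        _ ≤ m * l ^ 2 := by gcongr
    calc 13 * m * Real.log r / r ≤ 13 * m * (r - 1) / r := by gcongr
      _ = m / (16 * r ^ 4 * n ^ 2) * (208 * (r - 1) * r ^ 3 * n ^ 2) := by
        field_simp
        ring
      _ ≤ m / (16 * r ^ 4 * n ^ 2) * (m * l ^ 2) := by gcongr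
      _ = (m * l / (r ^ 2 * n) / 4) ^ 2 := by
        field_simp
        ring
  have hlin : (r + 1) / r * (n / L) ≤ m * l / (r ^ 2 * n) / 2 := by
    have hl12 : 12 * r ≤ l := by nlinarith [pow_pos hr0 2, mul_pos hr0 hr0]
    have hfactor : 4 * r * (r + 1) ≤ (r - 1) * l := by
      nlinarith [mul_le_mul_of_nonneg_left hl12 hr1.le]
    calc (r + 1) / r * (n / L) = n / (4 * r ^ 2 * L) * (4 * r * (r + 1)) := by
          field_simp
      _ ≤ n / (4 * r ^ 2 * L) * ((r - 1) * l) := by gcongr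
      _ = n ^ 2 * (r - 1) / (2 * L) * l / (r ^ 2 * n) / 2 := by
        field_simp
        ring
      _ ≤ m * l / (r ^ 2 * n) / 2 := by gcongr
  linarith

theorem mul_cube_le_of_lt_rpow_one_fifth {r L : ℝ} (hr : 0 ≤ r) (hL : 200000000 ≤ L)
    (h : r < L ^ ((1 : ℝ) / 5)) : 1664 * r ^ 3 ≤ L := by
  have h5 : r ^ 5 ≤ L := by
    calc r ^ 5 ≤ (L ^ ((1 : ℝ) / 5)) ^ 5 := by gcongr
      _ = L := by
        rw [← Real.rpow_natCast, ← Real.rpow_mul (by linarith)]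
        norm_num
  rcases le_total r 41 with h41 | h41
  · have : r ^ 3 ≤ 41 ^ 3 := by gcongr
    linarith
  · have h2 : (41 : ℝ) ^ 2 ≤ r ^ 2 := by gcongr
    nlinarith [pow_nonneg hr 3, mul_le_mul_of_nonneg_left h2 (pow_nonneg hr 3)]

theorem eventually_log_bounds :
    ∀ᶠ n : ℕ in Filter.atTop, 200000000 ≤ Real.log n ∧
      Real.log (Real.log n) ≤ Real.log n / 2 ∧ Real.log n ≤ (n : ℝ) / 2 := by
  have hlog : ∀ᶠ x : ℝ in Filter.atTop, Real.log x ≤ x / 2 := by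
    filter_upwards [Real.isLittleO_log_id_atTop.bound (c := 1 / 2) (by norm_num),
      Filter.eventually_ge_atTop 0] with x hx hx0
    rw [id, Real.norm_of_nonneg hx0] at hx
    linarith [Real.le_norm_self (Real.log x)]
  have hcast : Filter.Tendsto (fun n : ℕ => (n : ℝ)) Filter.atTop Filter.atTop :=
    tendsto_natCast_atTop_atTop
  have ht := Real.tendsto_log_atTop.comp hcast
  filter_upwards [ht.eventually_ge_atTop 200000000, ht.eventually hlog, hcast.eventually hlog]
    with n h1 h2 h3
  exact ⟨h1, h2, h3⟩


theorem helper_set_chernoff :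
    ∃ N : ℕ, ∀ n : ℕ, N ≤ n → ∀ m r : ℕ,
      2 ≤ r →
      (r : ℝ) < (Real.log n) ^ ((1 : ℝ) / 5) →
      (m : ℝ) ≥ (n : ℝ) ^ 2 * ((r : ℝ) - 1) / (2 * Real.log n) →
      ∀ p q : ℝ,
        p = (((r : ℝ) - 1) / r) * Real.log ((n : ℝ) / Real.log n) / n →
        q = (m : ℝ) * p / ((r : ℝ) * ((r : ℝ) - 1)) +
              2 * Real.sqrt (13 * (m : ℝ) * Real.log r / r) +
              (((r : ℝ) + 1) / r) * ((n : ℝ) / Real.log n) →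
        (∑ i ∈ (Finset.range (m + 1)).filter
              (fun i : ℕ => (i : ℝ) < q - Real.sqrt (13 * (m : ℝ) * Real.log r / r)),
            (m.choose i : ℝ) * (q / m) ^ i * (1 - q / m) ^ (m - i)) ≤
          Real.exp (-(13 * (m : ℝ) * Real.log r / r) / (2 * q)) ∧
        Real.exp (-(13 * (m : ℝ) * Real.log r / r) / (2 * q)) ≤ (r : ℝ) ^ (-(1 / p)) := by
  obtain ⟨N, hN⟩ := Filter.eventually_atTop.1 eventually_log_bounds
  refine ⟨N, fun n hn m r hr hrL hm p q hp hq => ?_⟩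
  obtain ⟨hL, hLL, hLn⟩ := hN n hn
  set L := Real.log n
  have hL0 : 0 < L := by linarith
  have hn0 : (0 : ℝ) < n := by linarith
  have hr2 : (2 : ℝ) ≤ r := by exact_mod_cast hr
  have hr0 : (0 : ℝ) < r := by linarith
  have hr1 : (0 : ℝ) < r - 1 := by linarith
  have hm0 : (0 : ℝ) < m := lt_of_lt_of_le (by positivity) hm
  have hLr := mul_cube_le_of_lt_rpow_one_fifth hr0.le hL hrL
  have hlog : Real.log (n / L) = L - Real.log L := Real.log_div hn0.ne' hL0.ne'
  have hl : L / 2 ≤ Real.log (n / L) := by linarith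
  have hlL : Real.log (n / L) ≤ L := by
    have := Real.log_nonneg (x := L) (by linarith)
    linarith
  set l := Real.log (n / L)
  have hl0 : 0 < l := by linarith
  have hp0 : 0 < p := by rw [hp]; positivity
  have hmain : (m : ℝ) * p / (r * (r - 1)) = m * l / (r ^ 2 * n) := by
    rw [hp]
    field_simp
  have hq0 : 0 < q := by rw [hq]; positivity
  have hqle : q ≤ 2 * (m * p / (r * (r - 1))) := by
    rw [hq, hmain]
    exact mean_le_two_mul_main_term hn0 hl hr2 hLr hm
  have hqm : q ≤ m := by
    refine hqle.trans ?_
    rw [hmain, ← mul_div_assoc, div_le_iff₀ (by positivity)]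
    have h2l : 2 * l ≤ r ^ 2 * n := by
      have h1 : (1 : ℝ) ≤ r ^ 2 := by nlinarith
      linarith [mul_le_mul_of_nonneg_right h1 hn0.le]
    nlinarith
  have hlogr : 0 ≤ Real.log r := Real.log_nonneg (by linarith)
  refine ⟨?_, ?_⟩
  · have h := sum_binomial_lower_tail_le (by exact_mod_cast hm0) hq0 hqm
      (Real.sqrt_nonneg (13 * (m : ℝ) * Real.log r / r))
    rwa [Real.sq_sqrt (by positivity)] at h
  · rw [Real.rpow_def_of_pos hr0]
    apply Real.exp_le_exp.2
    have hqr : 2 * q * r ≤ 13 * m * p := by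
      have h4 : 2 * (m * p / (r * (r - 1))) * r = 2 * (m * p) / (r - 1) := by
        field_simp
      have h5 : 2 * (m * p) / (r - 1) ≤ 2 * (m * p) :=
        div_le_self (by positivity) (by linarith)
      nlinarith [mul_le_mul_of_nonneg_right hqle hr0.le, mul_pos hm0 hp0]
    have hexp : 1 / p ≤ 13 * m / (2 * q * r) := by
      rw [div_le_div_iff₀ hp0 (by positivity)]
      linarith
    have h := mul_le_mul_of_nonneg_left hexp hlogr
    have heq : -(13 * (m : ℝ) * Real.log r / r) / (2 * q) =
        -(Real.log r * (13 * m / (2 * q * r))) := by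
      field_simp
    rw [heq]
    linarith
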